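/- There is a constant C > 0, independent of T, ψ and v, with the following property. Let ψ : [0,T]×ℝ³ → ℝ and v : [0,T]×ℝ³ → ℝ³ be smooth, Schwartz in the space variable for each t, with div v = 0. Then each of the three quantities |∫₀^T∫_{ℝ³} ∂₃ψ · ∂₃³ψ · ∂₃³v₃ dx dt|, |∫₀^T∫_{ℝ³} ∂₃²ψ · ∂₃³ψ · ∂₃²v₃ dx dt| and |∫₀^T∫_{ℝ³} ∂₃ψ · ∂₃³ψ · ∂₃²v₃ · ∂₃²ψ dx dt| is bounded by C ‖∇ψ‖_{L^∞_T(H²)} ‖∇_h∇ψ‖_{L²_T(H¹)} ‖∇v‖_{L²_T(H²)} (1 + ‖∇ψ‖_{L^∞_T(H²)}). -/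

import Mathlib

open MeasureTheory Real Set Filter
open scoped ENNReal NNReal

noncomputable section

/-- Spatial points of `ℝ³`. -/
abbrev Pt : Type := Fin 3 → ℝ

/-- Partial derivative in the `i`-th coordinate direction. -/
def pd (i : Fin 3) (f : Pt → ℝ) : Pt → ℝ := fun x => fderiv ℝ f x (Pi.single i 1)

/-- Iterated partial derivative `∂^α` for a multi-index `α`. -/
def pdM (α : Fin 3 → ℕ) (f : Pt → ℝ) : Pt → ℝ :=
  (pd 0)^[α 0] ((pd 1)^[α 1] ((pd 2)^[α 2] f))

/-- Multi-indices of total degree at most `k`. -/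
def midx (k : ℕ) : Finset (Fin 3 → ℕ) :=
  (Fintype.piFinset fun _ => Finset.range (k + 1)).filter fun α => ∑ i, α i ≤ k

/-- The `H^k` inner product `(f|g)_{H^k} = ∑_{|α| ≤ k} ∫ ∂^α f ∂^α g`. -/
def hInner (k : ℕ) (f g : Pt → ℝ) : ℝ := ∑ α ∈ midx k, ∫ x : Pt, pdM α f x * pdM α g x

/-- The squared `H^k` norm. -/
def hSq (k : ℕ) (f : Pt → ℝ) : ℝ := hInner k f f

/-- The squared `L²` norm. -/
def l2Sq (f : Pt → ℝ) : ℝ := ∫ x : Pt, (f x) ^ 2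

/-- The Laplacian. -/
def lapl (f : Pt → ℝ) : Pt → ℝ := fun x => ∑ i, pd i (pd i f) x

/-- Horizontal directions. -/
def hIdx : Finset (Fin 3) := {0, 1}

/-- `L^∞` norm in time over `[0,T]` of a (nonnegative) function of time. -/
def supT (T : ℝ) (g : ℝ → ℝ) : ℝ := sSup (g '' Icc 0 T)

/-- `L²` norm in time over `[0,T]`. -/
def l2T (T : ℝ) (g : ℝ → ℝ) : ℝ := Real.sqrt (∫ t in (0:ℝ)..T, (g t) ^ 2)

/-- `L⁴` norm in time over `[0,T]`. -/
def l4T (T : ℝ) (g : ℝ → ℝ) : ℝ := (∫ t in (0:ℝ)..T, (g t) ^ 4) ^ ((1:ℝ)/4)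

/-- A function is Schwartz: smooth with all derivatives rapidly decaying. -/
def IsSchwartz (f : Pt → ℝ) : Prop :=
  ContDiff ℝ (⊤ : ℕ∞) f ∧ ∀ k n : ℕ, ∃ C : ℝ, ∀ x, ‖x‖ ^ k * ‖iteratedFDeriv ℝ n f x‖ ≤ C

/-- Smoothness of `f` jointly in `(t,x)` on `s ×ˢ ℝ³`. -/
def SmoothOn2 (s : Set ℝ) (f : ℝ → Pt → ℝ) : Prop :=
  ContDiffOn ℝ (⊤ : ℕ∞) (fun q : ℝ × Pt => f q.1 q.2) (s ×ˢ (univ : Set Pt))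

/-- `‖∇f‖_{H^k}²`. -/
def gradHSq (k : ℕ) (f : Pt → ℝ) : ℝ := ∑ i, hSq k (pd i f)

/-- `‖∇_h∇f‖_{H^k}²`. -/
def gradHHSq (k : ℕ) (f : Pt → ℝ) : ℝ := ∑ i ∈ hIdx, ∑ j, hSq k (pd i (pd j f))

/-- `‖v‖_{H^k}²` for a vector field. -/
def vecHSq (k : ℕ) (v : Fin 3 → Pt → ℝ) : ℝ := ∑ j, hSq k (v j)

/-- `‖∇v‖_{H^k}²` for a vector field. -/
def gradVecHSq (k : ℕ) (v : Fin 3 → Pt → ℝ) : ℝ := ∑ j, gradHSq k (v j)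

/-- `B_T²`. -/
def BTsq (T : ℝ) (ψ : ℝ → Pt → ℝ) (v : Fin 3 → ℝ → Pt → ℝ) : ℝ :=
  (supT T fun t => Real.sqrt (vecHSq 2 fun j => v j t)) ^ 2
  + (supT T fun t => Real.sqrt (gradHSq 2 (ψ t))) ^ 2
  + (l2T T fun t => Real.sqrt (gradVecHSq 2 fun j => v j t)) ^ 2
  + (l2T T fun t => Real.sqrt (gradHHSq 1 (ψ t))) ^ 2

/-- `B_T`. -/
def BT (T : ℝ) (ψ : ℝ → Pt → ℝ) (v : Fin 3 → ℝ → Pt → ℝ) : ℝ := Real.sqrt (BTsq T ψ v)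

/-- The transport equation `∂_tψ + v·∇ψ + v₃ = 0` on `s × ℝ³`. -/
def TransportEq (s : Set ℝ) (ψ : ℝ → Pt → ℝ) (v : Fin 3 → ℝ → Pt → ℝ) : Prop :=
  ∀ t ∈ s, ∀ x, deriv (fun τ => ψ τ x) t + (∑ i, v i t x * pd i (ψ t) x) + v 2 t x = 0

/-- Divergence-free condition on `s × ℝ³`. -/
def DivFree (s : Set ℝ) (v : Fin 3 → ℝ → Pt → ℝ) : Prop :=
  ∀ t ∈ s, ∀ x, (∑ i, pd i (fun y => v i t y) x) = 0

/-- The momentum equations of system (S) on `s × ℝ³`. -/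
def MomentumEq (s : Set ℝ) (ψ : ℝ → Pt → ℝ) (v : Fin 3 → ℝ → Pt → ℝ)
    (p : ℝ → Pt → ℝ) : Prop :=
  ∀ j : Fin 3, ∀ t ∈ s, ∀ x,
    deriv (fun τ => v j τ x) t + (∑ i, v i t x * pd i (v j t) x) - lapl (v j t) x
      + pd j (p t) x + pd j (pd 2 (ψ t)) x + (if j = 2 then lapl (ψ t) x else 0)
    = - ∑ i, pd i (fun y => pd j (ψ t) y * pd i (ψ t) y) x

/-- The full system (S) on `s × ℝ³`. -/
def SolvesS (s : Set ℝ) (ψ : ℝ → Pt → ℝ) (v : Fin 3 → ℝ → Pt → ℝ)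
    (p : ℝ → Pt → ℝ) : Prop :=
  TransportEq s ψ v ∧ MomentumEq s ψ v p ∧ DivFree s v

/-- Finiteness of the four norms entering `B_T`. -/
def FiniteClass (T : ℝ) (ψ : ℝ → Pt → ℝ) (v : Fin 3 → ℝ → Pt → ℝ) : Prop :=
  BddAbove ((fun t => Real.sqrt (vecHSq 2 fun j => v j t)) '' Icc 0 T) ∧
  BddAbove ((fun t => Real.sqrt (gradHSq 2 (ψ t))) '' Icc 0 T) ∧
  IntervalIntegrable (fun t => gradVecHSq 2 fun j => v j t) volume 0 T ∧
  IntervalIntegrable (fun t => gradHHSq 1 (ψ t)) volume 0 T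

lemma IsSchwartz.exists_schwartzMap {f : Pt → ℝ} (hf : IsSchwartz f) :
    ∃ g : SchwartzMap Pt ℝ, ⇑g = f :=
  ⟨⟨f, hf.1, hf.2⟩, rfl⟩

lemma SchwartzMap.isSchwartz (g : SchwartzMap Pt ℝ) : IsSchwartz g :=
  ⟨g.smooth', g.decay'⟩

namespace IsSchwartz

variable {f g : Pt → ℝ}

lemma mul (hf : IsSchwartz f) (hg : IsSchwartz g) : IsSchwartz (fun x => f x * g x) := by
  obtain ⟨F, rfl⟩ := hf.exists_schwartzMap
  obtain ⟨G, rfl⟩ := hg.exists_schwartzMap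
  have := (SchwartzMap.smulLeftCLM ℝ F G).isSchwartz
  rwa [SchwartzMap.smulLeftCLM_apply F.hasTemperateGrowth] at this

protected lemma pd (i : Fin 3) (hf : IsSchwartz f) : IsSchwartz (pd i f) := by
  obtain ⟨F, rfl⟩ := hf.exists_schwartzMap
  exact (SchwartzMap.evalCLM ℝ Pt ℝ (Pi.single i 1) (SchwartzMap.fderivCLM ℝ Pt ℝ F)).isSchwartz

lemma pow (hf : IsSchwartz f) (n : ℕ) : IsSchwartz (fun x => f x ^ (n + 1)) := by
  induction n with
  | zero => simpa using hf
  | succ n ih => simpa only [pow_succ _ (n + 1)] using ih.mul hf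

lemma integrable (hf : IsSchwartz f) : Integrable f := by
  obtain ⟨F, rfl⟩ := hf.exists_schwartzMap
  exact F.integrable

lemma tendsto_cocompact (hf : IsSchwartz f) : Tendsto f (cocompact Pt) (nhds 0) := by
  obtain ⟨F, rfl⟩ := hf.exists_schwartzMap
  exact F.tendsto_cocompact

lemma continuous (hf : IsSchwartz f) : Continuous f := hf.1.continuous

lemma differentiable (hf : IsSchwartz f) : Differentiable ℝ f :=
  hf.1.differentiable (by simp)

lemma pd_mul (hf : IsSchwartz f) (hg : IsSchwartz g) (i : Fin 3) :
    pd i (fun x => f x * g x) =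
      fun x => pd i f x * g x + f x * pd i g x := by
  ext x
  unfold pd
  rw [fderiv_fun_mul (hf.differentiable x) (hg.differentiable x)]
  simp
  ring

lemma pd_comm (hf : IsSchwartz f) (i j : Fin 3) :
    pd i (pd j f) = pd j (pd i f) := by
  ext x
  have hd : DifferentiableAt ℝ (fderiv ℝ f) x :=
    (hf.1.fderiv_right (m := 1) (by norm_cast)).differentiable (by simp) x
  have key : ∀ k l : Fin 3, pd k (pd l f) x =
      fderiv ℝ (fderiv ℝ f) x (Pi.single k 1) (Pi.single l 1) := by
    intro k l
    unfold pd
    rw [fderiv_clm_apply hd (by fun_prop)]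
    simp
  rw [key, key]
  have hs : IsSymmSndFDerivAt ℝ f x :=
    hf.1.contDiffAt.isSymmSndFDerivAt (by simp; norm_cast)
  exact hs _ _

lemma integral_pd (hf : IsSchwartz f) (i : Fin 3) : ∫ x, pd i f x = 0 := by
  have h := integral_mul_fderiv_eq_neg_fderiv_mul_of_integrable (μ := (volume : Measure Pt))
    (f := fun _ => (1 : ℝ)) (g := f) (v := Pi.single i 1)
    (by simp) (by simpa using! (hf.pd i).integrable) (by simpa using hf.integrable)
    (by intro x _; fun_prop) (fun x _ => hf.differentiable x)
  simpa using! h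

end IsSchwartz

lemma sq_integral_mul_le {α : Type*} [MeasurableSpace α] {μ : Measure α} {f g : α → ℝ}
    (hff : Integrable (fun x => f x ^ 2) μ) (hgg : Integrable (fun x => g x ^ 2) μ)
    (hfg : Integrable (fun x => f x * g x) μ) :
    (∫ x, f x * g x ∂μ) ^ 2 ≤ (∫ x, f x ^ 2 ∂μ) * ∫ x, g x ^ 2 ∂μ := by
  have h : ∀ t : ℝ, 0 ≤
      (∫ x, f x ^ 2 ∂μ) * (t * t) + (2 * ∫ x, f x * g x ∂μ) * t + ∫ x, g x ^ 2 ∂μ := by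
    intro t
    have e : (∫ x, f x ^ 2 ∂μ) * (t * t) + (2 * ∫ x, f x * g x ∂μ) * t + ∫ x, g x ^ 2 ∂μ =
        ∫ x, (f x * t + g x) ^ 2 ∂μ := by
      have h1 : ∀ x, (f x * t + g x) ^ 2 = f x ^ 2 * (t * t) + (f x * g x) * (2 * t) + g x ^ 2 :=
        fun x => by ring
      simp_rw [h1]
      have hs : Integrable (fun x => f x ^ 2 * (t * t) + (f x * g x) * (2 * t)) μ :=
        (hff.mul_const _).add (hfg.mul_const _)
      rw [integral_add hs hgg,
        integral_add (hff.mul_const _) (hfg.mul_const _), integral_mul_const, integral_mul_const]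
      ring
    rw [e]
    exact integral_nonneg fun x => sq_nonneg _
  have := discrim_le_zero h
  unfold discrim at this
  nlinarith

/-- The squared `H¹` norm, written with first-order partial derivatives. -/
def hOneSq (f : Pt → ℝ) : ℝ := (∫ x, f x ^ 2) + ∑ i, ∫ x, pd i f x ^ 2

lemma hOneSq_nonneg (f : Pt → ℝ) : 0 ≤ hOneSq f :=
  add_nonneg (integral_nonneg fun _ => sq_nonneg _)
    (Finset.sum_nonneg fun _ _ => integral_nonneg fun _ => sq_nonneg _)

lemma mem_midx {k : ℕ} {α : Fin 3 → ℕ} : α ∈ midx k ↔ ∑ i, α i ≤ k := by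
  simp only [midx, Finset.mem_filter, Fintype.mem_piFinset, Finset.mem_range, and_iff_right_iff_imp]
  intro h i
  exact Nat.lt_succ_of_le ((Finset.single_le_sum (fun _ _ => Nat.zero_le _)
    (Finset.mem_univ i)).trans h)

lemma sum_integral_le_hSq {k : ℕ} (s : Finset (Fin 3 → ℕ)) (hs : s ⊆ midx k) (f : Pt → ℝ) :
    ∑ α ∈ s, ∫ x, pdM α f x ^ 2 ≤ hSq k f := by
  simp only [hSq, hInner, ← sq]
  exact Finset.sum_le_sum_of_subset_of_nonneg hs
    fun _ _ _ => integral_nonneg fun _ => sq_nonneg _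

lemma integral_sq_pdM_le_hSq {k : ℕ} {α : Fin 3 → ℕ} (hα : α ∈ midx k) (f : Pt → ℝ) :
    ∫ x, pdM α f x ^ 2 ≤ hSq k f := by
  simpa using sum_integral_le_hSq {α} (by simpa using hα) f

lemma hSq_nonneg (k : ℕ) (f : Pt → ℝ) : 0 ≤ hSq k f := by
  simpa using sum_integral_le_hSq (k := k) ∅ (by simp) f

lemma pdM_zero (f : Pt → ℝ) : pdM 0 f = f := rfl

lemma pdM_single (i : Fin 3) (f : Pt → ℝ) : pdM (Pi.single i 1) f = pd i f := by
  fin_cases i <;> simp [pdM]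

lemma pdM_add (f : Pt → ℝ) (hf : IsSchwartz f) (i j : Fin 3) :
    pdM (Pi.single i 1 + Pi.single j 1) f = pd i (pd j f) := by
  fin_cases i <;> fin_cases j <;> simp [pdM] <;> exact hf.pd_comm _ _

lemma integral_sq_le_hSq (k : ℕ) (f : Pt → ℝ) : ∫ x, f x ^ 2 ≤ hSq k f := by
  simpa only [pdM_zero] using integral_sq_pdM_le_hSq (k := k) (α := 0) (by simp [mem_midx]) f

lemma integral_sq_pd_le_hSq {k : ℕ} (hk : 1 ≤ k) (i : Fin 3) (f : Pt → ℝ) :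
    ∫ x, pd i f x ^ 2 ≤ hSq k f := by
  simpa only [pdM_single] using
    integral_sq_pdM_le_hSq (k := k) (α := Pi.single i 1) (by simp [mem_midx, hk]) f

lemma integral_sq_pd_pd_le_hSq {f : Pt → ℝ} (hf : IsSchwartz f) (i j : Fin 3) :
    ∫ x, pd i (pd j f) x ^ 2 ≤ hSq 2 f := by
  rw [← pdM_add f hf i j]
  exact integral_sq_pdM_le_hSq (k := 2) (α := Pi.single i 1 + Pi.single j 1)
    (by simp [mem_midx, Finset.sum_add_distrib]) f

lemma hOneSq_le_hSq {k : ℕ} (hk : 1 ≤ k) (f : Pt → ℝ) : hOneSq f ≤ 4 * hSq k f := by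
  have h0 := integral_sq_le_hSq k f
  have h1 := fun i => integral_sq_pd_le_hSq hk i f
  have := h1 0
  have := h1 1
  have := h1 2
  rw [hOneSq, Fin.sum_univ_three]
  linarith

lemma hOneSq_pd_le_hSq {f : Pt → ℝ} (hf : IsSchwartz f) (i : Fin 3) :
    hOneSq (pd i f) ≤ 4 * hSq 2 f := by
  have h0 := integral_sq_pd_le_hSq one_le_two i f
  have h1 := fun j => integral_sq_pd_pd_le_hSq hf j i
  have := h1 0
  have := h1 1
  have := h1 2
  rw [hOneSq, Fin.sum_univ_three]
  linarith

lemma norm_fderiv_apply_le (f : Pt → ℝ) (x y : Pt) :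
    ‖fderiv ℝ f x y‖ ≤ (∑ i, |pd i f x|) * ‖y‖ := by
  have h : fderiv ℝ f x y = ∑ i, y i * pd i f x := by
    conv_lhs => rw [← Finset.univ_sum_single y]
    rw [map_sum]
    refine Finset.sum_congr rfl fun i _ => ?_
    have : (Pi.single i (y i) : Pt) = y i • Pi.single i 1 := by
      rw [← Pi.single_smul]; simp
    rw [this, map_smul, smul_eq_mul, pd]
  rw [h, Finset.sum_mul]
  refine (norm_sum_le _ _).trans (Finset.sum_le_sum fun i _ => ?_)
  rw [norm_mul, mul_comm, Real.norm_eq_abs (pd i f x)]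
  gcongr
  exact norm_le_pi_norm y i

lemma norm_fderiv_le (f : Pt → ℝ) (x : Pt) : ‖fderiv ℝ f x‖ ≤ ∑ i, |pd i f x| :=
  ContinuousLinearMap.opNorm_le_bound _ (Finset.sum_nonneg fun _ _ => abs_nonneg _)
    (norm_fderiv_apply_le f x)

lemma enorm_le_lintegral_deriv {u : ℝ → ℝ} (hu : ContDiff ℝ 1 u)
    (h0 : Tendsto u atBot (nhds 0)) (a : ℝ) : ‖u a‖ₑ ≤ ∫⁻ y, ‖deriv u y‖ₑ := by
  by_cases hfin : ∫⁻ y, ‖deriv u y‖ₑ = ⊤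
  · simp [hfin]
  have hint : Integrable (deriv u) :=
    ⟨(hu.continuous_deriv le_rfl).aestronglyMeasurable, Ne.lt_top hfin⟩
  have h := integral_Iic_of_hasDerivAt_of_tendsto' (a := a)
    (fun x _ => (hu.differentiable one_ne_zero x).hasDerivAt) hint.integrableOn h0
  rw [sub_zero] at h
  rw [← h]
  exact (enorm_integral_le_lintegral_enorm _).trans (setLIntegral_le_lintegral _ _)

/-- The Gagliardo–Nirenberg–Sobolev inequality on `ℝ³` for Schwartz functions. -/
lemma IsSchwartz.lintegral_rpow_le {u : Pt → ℝ} (hu : IsSchwartz u) :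
    ∫⁻ x, ‖u x‖ₑ ^ (3 / 2 : ℝ) ≤ (∫⁻ x, ‖fderiv ℝ u x‖ₑ) ^ (3 / 2 : ℝ) := by
  have hp : Real.HolderConjugate (Fintype.card (Fin 3)) (3 / 2 : ℝ) := by
    rw [Real.holderConjugate_iff]; norm_num
  have hc : ContDiff ℝ 1 u := hu.1.of_le (by norm_cast)
  have hF : Measurable fun x => ‖fderiv ℝ u x‖ₑ := by fun_prop
  refine le_trans ?_ (lintegral_prod_lintegral_pow_le (fun _ : Fin 3 => (volume : Measure ℝ)) hp hF)
  refine lintegral_mono fun x => ?_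
  have hpt : ∀ i : Fin 3, ‖u x‖ₑ ≤ ∫⁻ y, ‖fderiv ℝ u (Function.update x i y)‖ₑ := by
    intro i
    have hup : ContDiff ℝ 1 (u ∘ Function.update x i) := hc.comp (by convert! contDiff_update 1 x i)
    have ht : Tendsto (u ∘ Function.update x i) atBot (nhds 0) := by
      refine hu.tendsto_cocompact.comp ?_
      exact ((isClosedEmbedding_update x i).tendsto_cocompact).mono_left atBot_le_cocompact
    have h1 := enorm_le_lintegral_deriv hup ht (x i)
    simp only [Function.comp_apply, Function.update_eq_self] at h1
    refine h1.trans (lintegral_mono fun y => ?_)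
    calc ‖deriv (u ∘ Function.update x i) y‖ₑ
        = ‖fderiv ℝ u (Function.update x i y) (deriv (Function.update x i) y)‖ₑ := by
          rw [fderiv_comp_deriv _ (hc.differentiable one_ne_zero).differentiableAt
            (hasDerivAt_update x i y).differentiableAt]
      _ ≤ ‖fderiv ℝ u (Function.update x i y)‖ₑ * ‖deriv (Function.update x i) y‖ₑ :=
          ContinuousLinearMap.le_opENorm _ _
      _ ≤ ‖fderiv ℝ u (Function.update x i y)‖ₑ := by simp [deriv_update, Pi.enorm_single]
  calc ‖u x‖ₑ ^ (3 / 2 : ℝ) = ∏ _i : Fin 3, ‖u x‖ₑ ^ ((1 : ℝ) / (Fintype.card (Fin 3) - 1)) := by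
        rw [Finset.prod_const, ← ENNReal.rpow_natCast, ← ENNReal.rpow_mul]
        norm_num
    _ ≤ _ := Finset.prod_le_prod' fun i _ => ENNReal.rpow_le_rpow (hpt i) (by norm_num)

lemma IsSchwartz.integral_pow_six_le {f : Pt → ℝ} (hf : IsSchwartz f) :
    ∫ x, f x ^ 6 ≤ 4096 * (∫ x, (∑ i, |pd i f x|) ^ 2) ^ 3 := by
  set A := ∫ x, f x ^ 6 with hA
  set D := ∫ x, (∑ i, |pd i f x|) ^ 2 with hD
  have hA0 : 0 ≤ A := integral_nonneg fun x => by positivity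
  have hD0 : 0 ≤ D := integral_nonneg fun x => by positivity
  have hG2 : Integrable fun x => (∑ i, |pd i f x|) ^ 2 := by
    simp only [sq, Finset.sum_mul_sum, ← abs_mul]
    exact integrable_finsetSum _ fun i _ => integrable_finsetSum _ fun j _ =>
      ((hf.pd i).mul (hf.pd j)).integrable.abs
  have hfG : Integrable fun x => |f x ^ 3| * ∑ i, |pd i f x| := by
    simp only [Finset.mul_sum, ← abs_mul]
    exact integrable_finsetSum _ fun i _ => ((hf.pow 2).mul (hf.pd i)).integrable.abs
  have hf6 : Integrable fun x => f x ^ 6 := (hf.pow 5).integrable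
  set J := ∫ x, |f x ^ 3| * ∑ i, |pd i f x| with hJ
  have hJ0 : 0 ≤ J := integral_nonneg fun x => by positivity
  have hJ2 : J ^ 2 ≤ A * D := by
    have e : ∀ x, |f x ^ 3| ^ 2 = f x ^ 6 := fun x => by rw [sq_abs]; ring
    have := sq_integral_mul_le (f := fun x => |f x ^ 3|) (g := fun x => ∑ i, |pd i f x|)
      (by simpa only [e] using hf6) hG2 hfG
    simpa only [e] using this
  have hAJ : A ^ 2 ≤ (4 * J) ^ 3 := by
    have h := (hf.pow 3).lintegral_rpow_le
    have hl : ∫⁻ x, ‖f x ^ (3 + 1)‖ₑ ^ (3 / 2 : ℝ) = ENNReal.ofReal A := by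
      rw [hA, ofReal_integral_eq_lintegral_ofReal hf6 (ae_of_all _ fun x => by positivity)]
      refine lintegral_congr fun x => ?_
      rw [← ofReal_norm, ENNReal.ofReal_rpow_of_nonneg (norm_nonneg _) (by norm_num)]
      congr 1
      rw [norm_pow, ← Real.rpow_natCast, ← Real.rpow_mul (norm_nonneg _)]
      norm_num
      exact Even.pow_abs (by decide) _
    have hr : ∫⁻ x, ‖fderiv ℝ (fun x => f x ^ (3 + 1)) x‖ₑ ≤ ENNReal.ofReal (4 * J) := by
      rw [hJ, ← integral_const_mul,
        ofReal_integral_eq_lintegral_ofReal (hfG.const_mul _) (ae_of_all _ fun x => by positivity)]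
      refine lintegral_mono fun x => ?_
      rw [← ofReal_norm]
      refine ENNReal.ofReal_le_ofReal ?_
      rw [fderiv_fun_pow _ (hf.differentiable x), norm_smul]
      have := norm_fderiv_le f x
      simp only [Real.norm_eq_abs, abs_mul, Nat.add_sub_cancel, nsmul_eq_mul]
      norm_num
      rw [mul_assoc]
      gcongr
    rw [hl] at h
    have h2 := h.trans (ENNReal.rpow_le_rpow hr (by norm_num))
    rw [ENNReal.ofReal_rpow_of_nonneg (by positivity) (by norm_num),
      ENNReal.ofReal_le_ofReal_iff (by positivity)] at h2
    calc A ^ 2 ≤ ((4 * J) ^ (3 / 2 : ℝ)) ^ 2 := by gcongr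
      _ = (4 * J) ^ 3 := by
        rw [← Real.rpow_natCast, ← Real.rpow_mul (by positivity), ← Real.rpow_natCast]
        norm_num
  by_cases hz : A = 0
  · rw [hz]; positivity
  have hpos : 0 < A := lt_of_le_of_ne hA0 (Ne.symm hz)
  have h4 : A ^ 3 * A ≤ A ^ 3 * (4096 * D ^ 3) := by
    calc A ^ 3 * A = (A ^ 2) ^ 2 := by ring
      _ ≤ ((4 * J) ^ 3) ^ 2 := by gcongr
      _ = 4096 * (J ^ 2) ^ 3 := by ring
      _ ≤ 4096 * (A * D) ^ 3 := by gcongr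
      _ = A ^ 3 * (4096 * D ^ 3) := by ring
  exact le_of_mul_le_mul_left h4 (by positivity)

/-- The Sobolev embedding `H¹(ℝ³) ⊂ L⁴(ℝ³)` for Schwartz functions. -/
lemma IsSchwartz.integral_pow_four_le {f : Pt → ℝ} (hf : IsSchwartz f) :
    ∫ x, f x ^ 4 ≤ 512 * hOneSq f ^ 2 := by
  have hE := hOneSq_nonneg f
  have h1 : (∫ x, f x ^ 4) ^ 2 ≤ (∫ x, f x ^ 2) * ∫ x, f x ^ 6 := by
    have e : ∀ x, f x * f x ^ 3 = f x ^ 4 := fun x => by ring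
    have e' : ∀ x, (f x ^ 3) ^ 2 = f x ^ 6 := fun x => by ring
    have := sq_integral_mul_le (f := f) (g := fun x => f x ^ 3) (hf.pow 1).integrable
      (by simpa only [e'] using (hf.pow 5).integrable)
      (by simpa only [e] using (hf.pow 3).integrable)
    simpa only [e, e'] using this
  have hsq : ∀ i, Integrable fun x => pd i f x ^ 2 := fun i => ((hf.pd i).pow 1).integrable
  have h2 : ∫ x, (∑ i, |pd i f x|) ^ 2 ≤ 3 * hOneSq f := by
    calc ∫ x, (∑ i, |pd i f x|) ^ 2 ≤ ∫ x, 3 * ∑ i, pd i f x ^ 2 := by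
          refine integral_mono_of_nonneg (ae_of_all _ fun x => by positivity)
            ((integrable_finsetSum _ fun i _ => hsq i).const_mul _) (ae_of_all _ fun x => ?_)
          have := sq_sum_le_card_mul_sum_sq (s := Finset.univ) (f := fun i => |pd i f x|)
          simpa using this
      _ = 3 * ∑ i, ∫ x, pd i f x ^ 2 := by
          rw [integral_const_mul, integral_finsetSum _ fun i _ => hsq i]
      _ ≤ 3 * hOneSq f := by
          have : 0 ≤ ∫ x, f x ^ 2 := integral_nonneg fun _ => sq_nonneg _
          unfold hOneSq
          linarith
  have h3 : ∫ x, f x ^ 2 ≤ hOneSq f :=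
    le_add_of_nonneg_right (Finset.sum_nonneg fun _ _ => integral_nonneg fun _ => sq_nonneg _)
  have h0 : 0 ≤ ∫ x, (∑ i, |pd i f x|) ^ 2 := integral_nonneg fun _ => sq_nonneg _
  have h6 := hf.integral_pow_six_le
  refine le_of_sq_le_sq ?_ (by positivity)
  calc (∫ x, f x ^ 4) ^ 2 ≤ (∫ x, f x ^ 2) * ∫ x, f x ^ 6 := h1
    _ ≤ hOneSq f * (4096 * (3 * hOneSq f) ^ 3) := by
        have h60 : 0 ≤ ∫ x, f x ^ 6 := integral_nonneg fun x => by positivity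
        exact mul_le_mul h3 (h6.trans (by gcongr)) h60 hE
    _ ≤ (512 * hOneSq f ^ 2) ^ 2 := by nlinarith [pow_nonneg hE 4]

lemma integral_pow_four_mul_le {f g : Pt → ℝ} (hf : IsSchwartz f) (hg : IsSchwartz g) :
    (∫ x, (f x * g x) ^ 2) ^ 2 ≤ (∫ x, f x ^ 4) * ∫ x, g x ^ 4 := by
  have e : ∀ h : Pt → ℝ, ∀ x, (h x ^ 2) ^ 2 = h x ^ 4 := fun h x => by ring
  have := sq_integral_mul_le (f := fun x => f x ^ 2) (g := fun x => g x ^ 2)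
    (by simpa only [e] using (hf.pow 3).integrable)
    (by simpa only [e] using (hg.pow 3).integrable) ((hf.pow 1).mul (hg.pow 1)).integrable
  simpa only [e, mul_pow] using this

lemma integral_sq_mul_le_of_pow_four {f g : Pt → ℝ} (hf : IsSchwartz f) (hg : IsSchwartz g)
    {a b : ℝ} (hfa : ∫ x, f x ^ 4 ≤ a ^ 4) (hgb : ∫ x, g x ^ 4 ≤ b ^ 4) :
    ∫ x, (f x * g x) ^ 2 ≤ (a * b) ^ 2 := by
  have h0 : 0 ≤ ∫ x, g x ^ 4 := integral_nonneg fun x => by positivity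
  refine le_of_sq_le_sq ?_ (by positivity)
  calc _ ≤ (∫ x, f x ^ 4) * ∫ x, g x ^ 4 := integral_pow_four_mul_le hf hg
    _ ≤ a ^ 4 * b ^ 4 := by gcongr
    _ = _ := by ring

lemma integral_sq_mul_le_of_abs_le {f g : Pt → ℝ} (hf : IsSchwartz f) (hg : IsSchwartz g)
    {a b : ℝ} (hfa : ∀ x, |f x| ≤ a) (hgb : ∫ x, g x ^ 2 ≤ b ^ 2) :
    ∫ x, (f x * g x) ^ 2 ≤ (a * b) ^ 2 := by
  calc ∫ x, (f x * g x) ^ 2 ≤ ∫ x, a ^ 2 * g x ^ 2 := by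
        refine integral_mono ((hf.mul hg).pow 1).integrable
          ((hg.pow 1).integrable.const_mul _) fun x => ?_
        have := sq_le_sq' (neg_le_of_abs_le (hfa x)) (le_of_abs_le (hfa x))
        simp only [mul_pow]
        gcongr
    _ = a ^ 2 * ∫ x, g x ^ 2 := integral_const_mul _ _
    _ ≤ a ^ 2 * b ^ 2 := by gcongr
    _ = _ := by ring

lemma abs_integral_mul_le {f g : Pt → ℝ} (hf : IsSchwartz f) (hg : IsSchwartz g)
    {a b : ℝ} (ha : 0 ≤ a) (hb : 0 ≤ b) (hfa : ∫ x, f x ^ 2 ≤ a ^ 2) (hgb : ∫ x, g x ^ 2 ≤ b ^ 2) :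
    |∫ x, f x * g x| ≤ a * b := by
  have h0 : 0 ≤ ∫ x, g x ^ 2 := integral_nonneg fun x => by positivity
  refine abs_le_of_sq_le_sq ?_ (by positivity)
  calc _ ≤ (∫ x, f x ^ 2) * ∫ x, g x ^ 2 :=
        sq_integral_mul_le (hf.pow 1).integrable (hg.pow 1).integrable (hf.mul hg).integrable
    _ ≤ a ^ 2 * b ^ 2 := by gcongr
    _ = _ := by ring

lemma lintegral_comp_add_smul (g : Pt → ℝ≥0∞) (x : Pt) {t : ℝ} (ht : 0 < t) :
    ∫⁻ y, g (x + t • y) = ENNReal.ofReal (t ^ (-3 : ℝ)) * ∫⁻ y, g y := by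
  have h1 : ∫⁻ y, g (x + t • y) = ∫⁻ z, g (x + z) ∂(Measure.map (t • ·) (volume : Measure Pt)) :=
    (lintegral_map_equiv (fun z => g (x + z))
      (Homeomorph.smulOfNeZero t ht.ne').toMeasurableEquiv).symm
  rw [h1, Measure.map_addHaar_smul _ ht.ne', lintegral_smul_measure, lintegral_add_left_eq_self g x]
  congr 2
  rw [abs_of_nonneg (by positivity), Real.rpow_neg ht.le]
  simp

/-- The unit ball of `ℝ³` (in the sup norm). -/
abbrev unitBall : Set Pt := Metric.ball 0 1

lemma setLIntegral_unitBall_le (g : Pt → ℝ≥0∞) (hg : Measurable g) :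
    ∫⁻ y in unitBall, g y ≤
      (∫⁻ y, g y ^ (4 : ℝ)) ^ (1 / 4 : ℝ) * volume unitBall ^ (3 / 4 : ℝ) := by
  have h := ENNReal.lintegral_mul_le_Lp_mul_Lq (volume.restrict unitBall)
    (p := 4) (q := 4 / 3) (by rw [Real.holderConjugate_iff]; norm_num)
    hg.aemeasurable (g := fun _ => 1) (by fun_prop)
  simp only [Pi.mul_apply, mul_one, ENNReal.one_rpow, lintegral_const, one_mul,
    Measure.restrict_apply_univ] at h
  norm_num at h ⊢
  refine h.trans ?_
  gcongr
  exact Measure.restrict_le_self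

lemma volume_mul_enorm_le {f : Pt → ℝ} (hf : IsSchwartz f) (x : Pt) :
    volume unitBall * ‖f x‖ₑ ≤ (∫⁻ y in unitBall, ‖f (x + y)‖ₑ) +
      ∑ i, ∫⁻ t in Ioo (0 : ℝ) 1, ∫⁻ y in unitBall, ‖pd i f (x + t • y)‖ₑ := by
  have hm : ∀ i, Measurable fun q : Pt × ℝ => ‖pd i f (x + q.2 • q.1)‖ₑ := by
    intro i
    have := (hf.pd i).continuous
    exact Continuous.measurable (by fun_prop)
  have hpt : ∀ y ∈ unitBall, ‖f x‖ₑ ≤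
      ‖f (x + y)‖ₑ + ∑ i, ∫⁻ t in Ioo (0 : ℝ) 1, ‖pd i f (x + t • y)‖ₑ := by
    intro y hy
    have hd : ∀ t : ℝ, HasDerivAt (fun t : ℝ => f (x + t • y)) (fderiv ℝ f (x + t • y) y) t := by
      intro t
      have h1 : HasDerivAt (fun t : ℝ => x + t • y) y t := by
        simpa using ((hasDerivAt_id t).smul_const y).const_add x
      exact (hf.differentiable _).hasFDerivAt.comp_hasDerivAt t h1
    have hc : Continuous fun t : ℝ => fderiv ℝ f (x + t • y) y := by
      have := hf.1.continuous_fderiv (by simp)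
      fun_prop
    have hint := intervalIntegral.integral_eq_sub_of_hasDerivAt (fun t _ => hd t)
      (hc.intervalIntegrable 0 1)
    simp only [one_smul, zero_smul, add_zero] at hint
    have e : f x = f (x + y) - ∫ t in (0 : ℝ)..1, fderiv ℝ f (x + t • y) y := by
      rw [hint]; ring
    rw [e]
    refine (enorm_sub_le).trans (add_le_add_right ?_ _)
    rw [intervalIntegral.integral_of_le zero_le_one]
    refine (enorm_integral_le_lintegral_enorm _).trans ?_
    rw [← lintegral_finsetSum', ← restrict_Ioo_eq_restrict_Ioc]
    · refine lintegral_mono fun t => ?_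
      have h2 : ‖fderiv ℝ f (x + t • y) y‖ ≤ ∑ i, |pd i f (x + t • y)| := by
        refine (norm_fderiv_apply_le f _ y).trans (mul_le_of_le_one_right
          (Finset.sum_nonneg fun _ _ => abs_nonneg _) ?_)
        exact (mem_ball_zero_iff.1 hy).le
      calc ‖fderiv ℝ f (x + t • y) y‖ₑ = ENNReal.ofReal ‖fderiv ℝ f (x + t • y) y‖ :=
            (ofReal_norm _).symm
        _ ≤ ENNReal.ofReal (∑ i, |pd i f (x + t • y)|) := ENNReal.ofReal_le_ofReal h2
        _ = _ := by
          rw [ENNReal.ofReal_sum_of_nonneg fun _ _ => abs_nonneg _]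
          exact Finset.sum_congr rfl fun i _ => by
            rw [← ofReal_norm, Real.norm_eq_abs]
    · exact fun i _ => ((hm i).comp (by fun_prop : Measurable fun t : ℝ => (y, t))).aemeasurable
  calc volume unitBall * ‖f x‖ₑ = ∫⁻ _ in unitBall, ‖f x‖ₑ := by
        rw [setLIntegral_const, mul_comm]
    _ ≤ ∫⁻ y in unitBall,
          (‖f (x + y)‖ₑ + ∑ i, ∫⁻ t in Ioo (0 : ℝ) 1, ‖pd i f (x + t • y)‖ₑ) :=
        setLIntegral_mono' Metric.isOpen_ball.measurableSet hpt
    _ = _ := by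
        have := hf.continuous
        rw [lintegral_add_left (Continuous.measurable (by fun_prop)),
          lintegral_finsetSum _ fun i _ => (hm i).lintegral_prod_right']
        congr 1
        exact Finset.sum_congr rfl fun i _ => lintegral_lintegral_swap (hm i).aemeasurable

lemma lintegral_Ioo_rpow_lt_top :
    ∫⁻ t in Ioo (0 : ℝ) 1, ENNReal.ofReal (t ^ (-3 / 4 : ℝ)) < ⊤ := by
  have h : IntegrableOn (fun t : ℝ => t ^ (-3 / 4 : ℝ)) (Ioo 0 1) :=
    (intervalIntegral.integrableOn_Ioo_rpow_iff zero_lt_one).2 (by norm_num)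
  exact (lintegral_mono fun t => Real.ofReal_le_enorm _).trans_lt h.2

lemma IsSchwartz.integral_pow_four_le_of_hOneSq_le {f : Pt → ℝ} (hf : IsSchwartz f) {a : ℝ}
    (h : hOneSq f ≤ 4 * a ^ 2) : ∫ x, f x ^ 4 ≤ (10 * a) ^ 4 := by
  have h0 := hOneSq_nonneg f
  calc ∫ x, f x ^ 4 ≤ 512 * hOneSq f ^ 2 := hf.integral_pow_four_le
    _ ≤ 512 * (4 * a ^ 2) ^ 2 := by gcongr
    _ ≤ (10 * a) ^ 4 := by nlinarith [sq_nonneg (a ^ 2)]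

lemma IsSchwartz.lintegral_pow_four_le {f : Pt → ℝ} (hf : IsSchwartz f) {a : ℝ} (ha : 0 ≤ a)
    (h : hOneSq f ≤ 4 * a ^ 2) :
    (∫⁻ x, ‖f x‖ₑ ^ (4 : ℝ)) ^ (1 / 4 : ℝ) ≤ ENNReal.ofReal (10 * a) := by
  have e : ∫⁻ x, ‖f x‖ₑ ^ (4 : ℝ) = ENNReal.ofReal (∫ x, f x ^ 4) := by
    have h4 : Integrable fun x => f x ^ 4 := (hf.pow 3).integrable
    rw [ofReal_integral_eq_lintegral_ofReal h4 (ae_of_all _ fun x => by positivity)]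
    refine lintegral_congr fun x => ?_
    rw [← ofReal_norm, ENNReal.ofReal_rpow_of_nonneg (norm_nonneg _) (by norm_num)]
    congr 1
    rw [show (4 : ℝ) = ((4 : ℕ) : ℝ) by norm_num, Real.rpow_natCast]
    exact Even.pow_abs (by decide) _
  rw [e]
  calc _ ≤ ENNReal.ofReal ((10 * a) ^ 4) ^ (1 / 4 : ℝ) := by
        gcongr
        exact hf.integral_pow_four_le_of_hOneSq_le h
    _ = ENNReal.ofReal (10 * a) := by
        rw [ENNReal.ofReal_rpow_of_nonneg (by positivity) (by norm_num), ← Real.rpow_natCast,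
          ← Real.rpow_mul (by positivity)]
        norm_num

/-- The Sobolev embedding `H²(ℝ³) ⊂ L^∞(ℝ³)` for Schwartz functions. -/
lemma exists_abs_le_of_hSq_le :
    ∃ M : ℝ, 0 < M ∧ ∀ f : Pt → ℝ, IsSchwartz f → ∀ a : ℝ, 0 ≤ a → hSq 2 f ≤ a ^ 2 →
      ∀ x, |f x| ≤ M * a := by
  set V := volume unitBall with hV
  have hV0 : V ≠ 0 := (Metric.measure_ball_pos volume (0 : Pt) one_pos).ne'
  have hVt : V ≠ ⊤ := measure_ball_lt_top.ne
  set I := ∫⁻ t in Ioo (0 : ℝ) 1, ENNReal.ofReal (t ^ (-3 / 4 : ℝ)) with hI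
  set W := V ^ (3 / 4 : ℝ) with hW
  have hWt : W ≠ ⊤ := ENNReal.rpow_ne_top_of_nonneg (by norm_num) hVt
  have hIt : I ≠ ⊤ := lintegral_Ioo_rpow_lt_top.ne
  set K := V⁻¹ * (W * (1 + 3 * I)) with hK
  have hKt : K ≠ ⊤ :=
    ENNReal.mul_ne_top (ENNReal.inv_ne_top.2 hV0) (ENNReal.mul_ne_top hWt
      (ENNReal.add_ne_top.2 ⟨ENNReal.one_ne_top, ENNReal.mul_ne_top (by norm_num) hIt⟩))
  refine ⟨10 * K.toReal + 1, by positivity, fun f hf a ha hfa x => ?_⟩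
  have h4 : (∫⁻ x, ‖f x‖ₑ ^ (4 : ℝ)) ^ (1 / 4 : ℝ) ≤ ENNReal.ofReal (10 * a) :=
    hf.lintegral_pow_four_le ha ((hOneSq_le_hSq one_le_two f).trans (by gcongr))
  have h4' : ∀ i, (∫⁻ x, ‖pd i f x‖ₑ ^ (4 : ℝ)) ^ (1 / 4 : ℝ) ≤ ENNReal.ofReal (10 * a) :=
    fun i => (hf.pd i).lintegral_pow_four_le ha ((hOneSq_pd_le_hSq hf i).trans (by gcongr))
  have hA : ∫⁻ y in unitBall, ‖f (x + y)‖ₑ ≤ ENNReal.ofReal (10 * a) * W := by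
    have := hf.continuous
    refine (setLIntegral_unitBall_le _ (Continuous.measurable (by fun_prop))).trans ?_
    rw [lintegral_add_left_eq_self (fun y => ‖f y‖ₑ ^ (4 : ℝ)) x]
    gcongr
  have hB : ∀ i, ∫⁻ t in Ioo (0 : ℝ) 1, ∫⁻ y in unitBall, ‖pd i f (x + t • y)‖ₑ ≤
      ENNReal.ofReal (10 * a) * W * I := by
    intro i
    rw [hI, ← lintegral_const_mul _ (by fun_prop)]
    refine setLIntegral_mono' measurableSet_Ioo fun t ht => ?_
    have := (hf.pd i).continuous
    refine (setLIntegral_unitBall_le _ (Continuous.measurable (by fun_prop))).trans ?_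
    rw [lintegral_comp_add_smul (fun y => ‖pd i f y‖ₑ ^ (4 : ℝ)) x ht.1,
      ENNReal.mul_rpow_of_nonneg _ _ (by norm_num),
      ENNReal.ofReal_rpow_of_nonneg (Real.rpow_nonneg ht.1.le _) (by norm_num),
      ← Real.rpow_mul ht.1.le, show (-3 : ℝ) * (1 / 4) = -3 / 4 by norm_num]
    calc _ ≤ ENNReal.ofReal (t ^ (-3 / 4 : ℝ)) * ENNReal.ofReal (10 * a) * W := by
          gcongr
          exact h4' i
      _ = _ := by ring
  have hS : V * ‖f x‖ₑ ≤ W * (1 + 3 * I) * ENNReal.ofReal (10 * a) := by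
    refine (volume_mul_enorm_le hf x).trans ?_
    rw [Fin.sum_univ_three]
    refine (add_le_add hA (add_le_add (add_le_add (hB 0) (hB 1)) (hB 2))).trans (le_of_eq ?_)
    ring
  have hF : ‖f x‖ₑ ≤ K * ENNReal.ofReal (10 * a) := by
    calc ‖f x‖ₑ = V⁻¹ * (V * ‖f x‖ₑ) := by
          rw [← mul_assoc, ENNReal.inv_mul_cancel hV0 hVt, one_mul]
      _ ≤ V⁻¹ * (W * (1 + 3 * I) * ENNReal.ofReal (10 * a)) := by gcongr
      _ = _ := by rw [hK]; ring
  rw [← ofReal_norm, ← ENNReal.ofReal_toReal hKt,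
    ← ENNReal.ofReal_mul ENNReal.toReal_nonneg,
    ENNReal.ofReal_le_ofReal_iff (by positivity), Real.norm_eq_abs] at hF
  nlinarith

section VerticalTerms

variable {P w : Pt → ℝ}

lemma integral_vertical_one (hP : IsSchwartz P) (hw : IsSchwartz w) (h : Fin 3) :
    ∫ x, P x * pd 2 (pd 2 P) x * pd h w x =
      -(∫ x, pd h P x * w x * pd 2 (pd 2 P) x) + (∫ x, pd 2 P x * w x * pd 2 (pd h P) x)
        + ∫ x, P x * pd 2 (pd h P) x * pd 2 w x := by
  have hX := hP.pd h
  have hY := hX.pd 2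
  have hQ := hP.pd 2
  have hR := hQ.pd 2
  have c : pd h (pd 2 (pd 2 P)) = pd 2 (pd 2 (pd h P)) := by
    rw [hQ.pd_comm h 2, hP.pd_comm h 2]
  have i1 := ((hP.mul hR).mul hw).integral_pd h
  have i2 := ((hP.mul hY).mul hw).integral_pd 2
  have e : ∀ x, P x * pd 2 (pd 2 P) x * pd h w x =
      pd h (fun x => P x * pd 2 (pd 2 P) x * w x) x - pd 2 (fun x => P x * pd 2 (pd h P) x * w x) x
        + (-(pd h P x * w x * pd 2 (pd 2 P) x) + pd 2 P x * w x * pd 2 (pd h P) x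
          + P x * pd 2 (pd h P) x * pd 2 w x) := by
    intro x
    rw [(hP.mul hR).pd_mul hw, hP.pd_mul hR, (hP.mul hY).pd_mul hw, hP.pd_mul hY, c]
    ring
  have j1 := (((hP.mul hR).mul hw).pd h).integrable
  have j2 := (((hP.mul hY).mul hw).pd 2).integrable
  have j3 := ((hX.mul hw).mul hR).integrable
  have j4 := ((hQ.mul hw).mul hY).integrable
  have j5 := ((hP.mul hY).mul (hw.pd 2)).integrable
  simp_rw [e]
  rw [integral_add (by exact j1.sub j2) (by exact (j3.neg.add j4).add j5), integral_sub j1 j2,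
    i1, i2, integral_add (by exact j3.neg.add j4) j5, integral_add (by exact j3.neg) j4,
    integral_neg]
  ring

lemma integral_vertical_two (hP : IsSchwartz P) (hw : IsSchwartz w) (h : Fin 3) :
    ∫ x, pd 2 P x * pd 2 (pd 2 P) x * pd h w x =
      ∫ x, pd 2 P x * pd 2 w x * pd 2 (pd h P) x := by
  have hQ := hP.pd 2
  have hG := hw.pd h
  have hz := hw.pd 2
  have hY := (hP.pd h).pd 2
  have i1 := ((hQ.mul hQ).mul hG).integral_pd 2
  have i2 := ((hQ.mul hQ).mul hz).integral_pd h
  have e : ∀ x, pd 2 P x * pd 2 (pd 2 P) x * pd h w x =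
      (1 / 2) * pd 2 (fun x => pd 2 P x * pd 2 P x * pd h w x) x
        - (1 / 2) * pd h (fun x => pd 2 P x * pd 2 P x * pd 2 w x) x
        + pd 2 P x * pd 2 w x * pd 2 (pd h P) x := by
    intro x
    rw [(hQ.mul hQ).pd_mul hG, hQ.pd_mul hQ, (hQ.mul hQ).pd_mul hz, hQ.pd_mul hQ,
      hw.pd_comm 2 h, hP.pd_comm 2 h]
    ring
  have j1 := (((hQ.mul hQ).mul hG).pd 2).integrable.const_mul (1 / 2)
  have j2 := (((hQ.mul hQ).mul hz).pd h).integrable.const_mul (1 / 2)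
  have j3 := ((hQ.mul hz).mul hY).integrable
  simp_rw [e]
  rw [integral_add (by exact j1.sub j2) j3, integral_sub j1 j2, integral_const_mul,
    integral_const_mul, i1, i2]
  ring

lemma integral_vertical_three (hP : IsSchwartz P) (hw : IsSchwartz w) (h : Fin 3) :
    ∫ x, P x * pd 2 (pd 2 P) x * pd h w x * pd 2 P x =
      (3 / 2) * (∫ x, (w x * pd 2 (pd h P) x) * (pd 2 P x * pd 2 P x))
        + (1 / 2) * (∫ x, (pd h P x * pd 2 P x) * (pd 2 P x * pd 2 w x))
        + ∫ x, (P x * pd 2 (pd h P) x) * (pd 2 P x * pd 2 w x) := by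
  have hX := hP.pd h
  have hQ := hP.pd 2
  have hG := hw.pd h
  have hz := hw.pd 2
  have hY := hX.pd 2
  have hQ2 := hQ.mul hQ
  have i1 := ((hP.mul hQ2).mul hG).integral_pd 2
  have i2 := ((hQ.mul hQ2).mul hw).integral_pd h
  have i3 := ((hP.mul hQ2).mul hz).integral_pd h
  have e : ∀ x, P x * pd 2 (pd 2 P) x * pd h w x * pd 2 P x =
      (1 / 2) * pd 2 (fun x => P x * (pd 2 P x * pd 2 P x) * pd h w x) x
        - (1 / 2) * pd h (fun x => pd 2 P x * (pd 2 P x * pd 2 P x) * w x) x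
        - (1 / 2) * pd h (fun x => P x * (pd 2 P x * pd 2 P x) * pd 2 w x) x
        + ((3 / 2) * ((w x * pd 2 (pd h P) x) * (pd 2 P x * pd 2 P x))
        + (1 / 2) * ((pd h P x * pd 2 P x) * (pd 2 P x * pd 2 w x))
        + (P x * pd 2 (pd h P) x) * (pd 2 P x * pd 2 w x)) := by
    intro x
    rw [(hP.mul hQ2).pd_mul hG, hP.pd_mul hQ2, (hQ.mul hQ2).pd_mul hw, hQ.pd_mul hQ2,
      (hP.mul hQ2).pd_mul hz, hP.pd_mul hQ2, hQ.pd_mul hQ, hQ.pd_mul hQ,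
      hw.pd_comm 2 h, hP.pd_comm 2 h]
    ring
  have j1 := (((hP.mul hQ2).mul hG).pd 2).integrable.const_mul (1 / 2)
  have j2 := (((hQ.mul hQ2).mul hw).pd h).integrable.const_mul (1 / 2)
  have j3 := (((hP.mul hQ2).mul hz).pd h).integrable.const_mul (1 / 2)
  have j4 := ((hw.mul hY).mul hQ2).integrable.const_mul (3 / 2)
  have j5 := ((hX.mul hQ).mul (hQ.mul hz)).integrable.const_mul (1 / 2)
  have j6 := ((hP.mul hY).mul (hQ.mul hz)).integrable
  simp_rw [e]
  rw [integral_add (by exact (j1.sub j2).sub j3) (by exact (j4.add j5).add j6),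
    integral_sub (by exact j1.sub j2) j3, integral_sub j1 j2, integral_add (by exact j4.add j5) j6,
    integral_add j4 j5]
  simp only [integral_const_mul, i1, i2, i3]
  ring

end VerticalTerms

lemma exists_slice_bound :
    ∃ C : ℝ, 0 < C ∧ ∀ P w : Pt → ℝ, IsSchwartz P → IsSchwartz w → ∀ (h : Fin 3) (a b c : ℝ),
      0 ≤ a → 0 ≤ b → 0 ≤ c → hSq 2 P ≤ a ^ 2 → hSq 1 (pd h P) ≤ b ^ 2 → hSq 2 w ≤ c ^ 2 →
      |∫ x, P x * pd 2 (pd 2 P) x * pd h (pd 2 w) x| ≤ C * a * b * c ∧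
      |∫ x, pd 2 P x * pd 2 (pd 2 P) x * pd h w x| ≤ C * a * b * c ∧
      |∫ x, P x * pd 2 (pd 2 P) x * pd h w x * pd 2 P x| ≤ C * a ^ 2 * b * c := by
  obtain ⟨M, hM, hsup⟩ := exists_abs_le_of_hSq_le
  refine ⟨5200 + 250 * M, by positivity, fun P w hP hw h a b c ha hb hc hPa hXb hwc => ?_⟩
  have hX := hP.pd h
  have hY := hX.pd 2
  have hQ := hP.pd 2
  have hR := hQ.pd 2
  have hz := hw.pd 2
  have bP := hsup P hP a ha hPa
  have bw := hsup w hw c hc hwc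
  have bQ : ∫ x, pd 2 P x ^ 4 ≤ (10 * a) ^ 4 :=
    hQ.integral_pow_four_le_of_hOneSq_le ((hOneSq_pd_le_hSq hP 2).trans (by gcongr))
  have bz : ∫ x, pd 2 w x ^ 4 ≤ (10 * c) ^ 4 :=
    hz.integral_pow_four_le_of_hOneSq_le ((hOneSq_pd_le_hSq hw 2).trans (by gcongr))
  have bX : ∫ x, pd h P x ^ 4 ≤ (10 * b) ^ 4 :=
    hX.integral_pow_four_le_of_hOneSq_le ((hOneSq_le_hSq le_rfl _).trans (by gcongr))
  have bR : ∫ x, pd 2 (pd 2 P) x ^ 2 ≤ a ^ 2 := (integral_sq_pd_pd_le_hSq hP 2 2).trans hPa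
  have bY : ∫ x, pd 2 (pd h P) x ^ 2 ≤ b ^ 2 := (integral_sq_pd_le_hSq le_rfl 2 _).trans hXb
  have bu : ∫ x, pd 2 (pd 2 w) x ^ 2 ≤ c ^ 2 := (integral_sq_pd_pd_le_hSq hw 2 2).trans hwc
  have k1 := abs_integral_mul_le (hX.mul hz) hR (by positivity) ha
    (integral_sq_mul_le_of_pow_four hX hz bX bz) bR
  have k2 := abs_integral_mul_le (hQ.mul hz) hY (by positivity) hb
    (integral_sq_mul_le_of_pow_four hQ hz bQ bz) bY
  have k3 := abs_integral_mul_le (hP.mul hY) (hz.pd 2) (by positivity) hc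
    (integral_sq_mul_le_of_abs_le hP hY bP bY) bu
  have k4 := abs_integral_mul_le (hw.mul hY) (hQ.mul hQ) (by positivity) (by positivity)
    (integral_sq_mul_le_of_abs_le hw hY bw bY) (integral_sq_mul_le_of_pow_four hQ hQ bQ bQ)
  have k5 := abs_integral_mul_le (hX.mul hQ) (hQ.mul hz) (by positivity) (by positivity)
    (integral_sq_mul_le_of_pow_four hX hQ bX bQ) (integral_sq_mul_le_of_pow_four hQ hz bQ bz)
  have k6 := abs_integral_mul_le (hP.mul hY) (hQ.mul hz) (by positivity) (by positivity)
    (integral_sq_mul_le_of_abs_le hP hY bP bY) (integral_sq_mul_le_of_pow_four hQ hz bQ bz)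
  have n1 : 0 ≤ a * b * c := by positivity
  have n2 : 0 ≤ a ^ 2 * b * c := by positivity
  have n3 : 0 ≤ M * (a * b * c) := by positivity
  have n4 : 0 ≤ M * (a ^ 2 * b * c) := by positivity
  rw [integral_vertical_one hP hz, integral_vertical_two hP hw, integral_vertical_three hP hw]
  rw [abs_le] at k1 k2 k3 k4 k5 k6 ⊢
  refine ⟨⟨?_, ?_⟩, ?_, ?_⟩
  · linarith
  · linarith
  · rw [abs_le]
    constructor <;> linarith
  · rw [abs_le]
    constructor <;> linarith

lemma IsSchwartz.pd_neg_add {f g : Pt → ℝ} (hf : IsSchwartz f) (hg : IsSchwartz g) (i : Fin 3) :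
    _root_.pd i (fun x => -(f x + g x)) = fun x => -(_root_.pd i f x + _root_.pd i g x) := by
  funext x
  have := ((hf.differentiable x).hasFDerivAt.add (hg.differentiable x).hasFDerivAt).neg.fderiv
  exact congrArg (fun L => L (Pi.single i 1)) this

lemma gradHSq_nonneg (k : ℕ) (f : Pt → ℝ) : 0 ≤ gradHSq k f :=
  Finset.sum_nonneg fun _ _ => hSq_nonneg k _

lemma gradHHSq_nonneg (k : ℕ) (f : Pt → ℝ) : 0 ≤ gradHHSq k f :=
  Finset.sum_nonneg fun _ _ => Finset.sum_nonneg fun _ _ => hSq_nonneg k _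

lemma gradVecHSq_nonneg (k : ℕ) (v : Fin 3 → Pt → ℝ) : 0 ≤ gradVecHSq k v :=
  Finset.sum_nonneg fun _ _ => gradHSq_nonneg k _

lemma exists_slice_bound_of_divFree :
    ∃ C : ℝ, 0 < C ∧ ∀ (ψ : Pt → ℝ) (v : Fin 3 → Pt → ℝ), IsSchwartz ψ → (∀ j, IsSchwartz (v j)) →
      (∀ x, ∑ i, pd i (v i) x = 0) → ∀ S, 0 ≤ S → √(gradHSq 2 ψ) ≤ S →
      |∫ x, pd 2 ψ x * pd 2 (pd 2 (pd 2 ψ)) x * pd 2 (pd 2 (pd 2 (v 2))) x| ≤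
        C * S * (1 + S) * (√(gradHHSq 1 ψ) * √(gradVecHSq 2 v)) ∧
      |∫ x, pd 2 (pd 2 ψ) x * pd 2 (pd 2 (pd 2 ψ)) x * pd 2 (pd 2 (v 2)) x| ≤
        C * S * (1 + S) * (√(gradHHSq 1 ψ) * √(gradVecHSq 2 v)) ∧
      |∫ x, pd 2 ψ x * pd 2 (pd 2 (pd 2 ψ)) x * pd 2 (pd 2 (v 2)) x * pd 2 (pd 2 ψ) x| ≤
        C * S * (1 + S) * (√(gradHHSq 1 ψ) * √(gradVecHSq 2 v)) := by
  obtain ⟨C, hC, hb⟩ := exists_slice_bound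
  refine ⟨2 * C, by positivity, fun ψ v hψ hv hdiv S hS hψS => ?_⟩
  have hP := hψ.pd 2
  have hR := (hP.pd 2).pd 2
  have hQ := hP.pd 2
  have hw0 := (hv 0).pd 2
  have hw1 := (hv 1).pd 2
  have e1 : pd 2 (v 2) = fun x => -(pd 0 (v 0) x + pd 1 (v 1) x) := by
    funext x
    have := hdiv x
    rw [Fin.sum_univ_three] at this
    linarith
  have e2 : pd 2 (pd 2 (v 2)) = fun x => -(pd 0 (pd 2 (v 0)) x + pd 1 (pd 2 (v 1)) x) := by
    rw [e1, ((hv 0).pd 0).pd_neg_add ((hv 1).pd 1), (hv 0).pd_comm 2 0, (hv 1).pd_comm 2 1]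
  have e3 : pd 2 (pd 2 (pd 2 (v 2))) =
      fun x => -(pd 0 (pd 2 (pd 2 (v 0))) x + pd 1 (pd 2 (pd 2 (v 1))) x) := by
    rw [e2, (hw0.pd 0).pd_neg_add (hw1.pd 1), hw0.pd_comm 2 0, hw1.pd_comm 2 1]
  have hG : hSq 2 (pd 2 ψ) ≤ gradHSq 2 ψ :=
    Finset.single_le_sum (f := fun i => hSq 2 (pd i ψ)) (fun i _ => hSq_nonneg 2 _)
      (Finset.mem_univ 2)
  have hPa : hSq 2 (pd 2 ψ) ≤ S ^ 2 := hG.trans ((Real.sqrt_le_left hS).1 hψS)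
  have hH : ∀ h ∈ hIdx, hSq 1 (pd h (pd 2 ψ)) ≤ √(gradHHSq 1 ψ) ^ 2 := by
    intro h hh
    have h1 : hSq 1 (pd h (pd 2 ψ)) ≤ ∑ j, hSq 1 (pd h (pd j ψ)) :=
      Finset.single_le_sum (f := fun j => hSq 1 (pd h (pd j ψ))) (fun j _ => hSq_nonneg 1 _)
        (Finset.mem_univ 2)
    have h2 : ∑ j, hSq 1 (pd h (pd j ψ)) ≤ gradHHSq 1 ψ :=
      Finset.single_le_sum (f := fun i => ∑ j, hSq 1 (pd i (pd j ψ)))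
        (fun i _ => Finset.sum_nonneg fun j _ => hSq_nonneg 1 _) hh
    rw [Real.sq_sqrt (gradHHSq_nonneg 1 ψ)]
    exact h1.trans h2
  have hV : ∀ h, hSq 2 (pd 2 (v h)) ≤ √(gradVecHSq 2 v) ^ 2 := by
    intro h
    have h1 : hSq 2 (pd 2 (v h)) ≤ gradHSq 2 (v h) :=
      Finset.single_le_sum (f := fun j => hSq 2 (pd j (v h))) (fun j _ => hSq_nonneg 2 _)
        (Finset.mem_univ 2)
    have h2 : gradHSq 2 (v h) ≤ gradVecHSq 2 v :=
      Finset.single_le_sum (f := fun i => gradHSq 2 (v i))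
        (fun i _ => gradHSq_nonneg 2 _) (Finset.mem_univ h)
    rw [Real.sq_sqrt (gradVecHSq_nonneg 2 v)]
    exact h1.trans h2
  have b0 := Real.sqrt_nonneg (gradHHSq 1 ψ)
  have c0 := Real.sqrt_nonneg (gradVecHSq 2 v)
  set b := √(gradHHSq 1 ψ)
  set c := √(gradVecHSq 2 v)
  have h0 := hb _ _ hP hw0 0 S b c hS b0 c0 hPa (hH 0 (by decide)) (hV 0)
  have h1 := hb _ _ hP hw1 1 S b c hS b0 c0 hPa (hH 1 (by decide)) (hV 1)
  have hn : 0 ≤ C * S * b * c := by positivity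
  have hn2 : 0 ≤ C * S ^ 2 * b * c := by positivity
  refine ⟨?_, ?_, ?_⟩
  · have i0 := ((hP.mul hR).mul ((hw0.pd 2).pd 0)).integrable
    have i1 := ((hP.mul hR).mul ((hw1.pd 2).pd 1)).integrable
    simp_rw [e3, mul_neg, mul_add]
    rw [integral_neg, integral_add i0 i1, abs_neg]
    refine (abs_add_le _ _).trans ?_
    linarith [h0.1, h1.1]
  · have i0 := ((hQ.mul hR).mul (hw0.pd 0)).integrable
    have i1 := ((hQ.mul hR).mul (hw1.pd 1)).integrable
    simp_rw [e2, mul_neg, mul_add]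
    rw [integral_neg, integral_add i0 i1, abs_neg]
    refine (abs_add_le _ _).trans ?_
    linarith [h0.2.1, h1.2.1]
  · have i0 := (((hP.mul hR).mul (hw0.pd 0)).mul hQ).integrable
    have i1 := (((hP.mul hR).mul (hw1.pd 1)).mul hQ).integrable
    simp_rw [e2, mul_neg, neg_mul, mul_add, add_mul]
    rw [integral_neg, integral_add i0 i1, abs_neg]
    refine (abs_add_le _ _).trans ?_
    linarith [h0.2.2, h1.2.2]

/-- A pointwise bound by `A * √F * √G` integrates by Cauchy–Schwarz in time. -/
lemma abs_integral_le_mul_l2T {T A : ℝ} (hT : 0 < T) (hA : 0 ≤ A) {u F G : ℝ → ℝ}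
    (hF0 : ∀ t, 0 ≤ F t) (hG0 : ∀ t, 0 ≤ G t) (hF : IntervalIntegrable F volume 0 T)
    (hG : IntervalIntegrable G volume 0 T)
    (hu : ∀ t ∈ Icc 0 T, |u t| ≤ A * (√(F t) * √(G t))) :
    |∫ t in (0 : ℝ)..T, u t| ≤
      A * ((l2T T fun t => √(F t)) * l2T T fun t => √(G t)) := by
  rw [intervalIntegrable_iff_integrableOn_Ioc_of_le hT.le] at hF hG
  have hff : IntegrableOn (fun t => √(F t) ^ 2) (Ioc 0 T) := by
    simpa only [Real.sq_sqrt (hF0 _)] using hF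
  have hgg : IntegrableOn (fun t => √(G t) ^ 2) (Ioc 0 T) := by
    simpa only [Real.sq_sqrt (hG0 _)] using hG
  have hfg : IntegrableOn (fun t => √(F t) * √(G t)) (Ioc 0 T) := by
    refine Integrable.mono' (hF.add hG)
      ((Real.continuous_sqrt.comp_aestronglyMeasurable hF.1).mul
        (Real.continuous_sqrt.comp_aestronglyMeasurable hG.1)) (ae_of_all _ fun t => ?_)
    rw [Real.norm_eq_abs, abs_of_nonneg (by positivity)]
    have h1 := Real.sq_sqrt (hF0 t)
    have h2 := Real.sq_sqrt (hG0 t)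
    simp only [Pi.add_apply]
    nlinarith [sq_nonneg (√(F t) - √(G t)), sq_nonneg (√(F t)), sq_nonneg (√(G t))]
  have key : ∫ t in Ioc 0 T, √(F t) * √(G t) ≤ (l2T T fun t => √(F t)) * l2T T fun t => √(G t) := by
    unfold l2T
    rw [intervalIntegral.integral_of_le hT.le, intervalIntegral.integral_of_le hT.le,
      ← Real.sqrt_mul (integral_nonneg fun t => sq_nonneg _)]
    exact Real.le_sqrt_of_sq_le (sq_integral_mul_le hff hgg hfg)
  calc |∫ t in (0 : ℝ)..T, u t| = ‖∫ t in Ioc 0 T, u t‖ := by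
        rw [intervalIntegral.integral_of_le hT.le, Real.norm_eq_abs]
    _ ≤ ∫ t in Ioc 0 T, A * (√(F t) * √(G t)) :=
        norm_integral_le_of_norm_le (hfg.const_mul A)
          ((ae_restrict_mem measurableSet_Ioc).mono fun t ht => hu t (Ioc_subset_Icc_self ht))
    _ = A * ∫ t in Ioc 0 T, √(F t) * √(G t) := integral_const_mul _ _
    _ ≤ _ := by gcongr

/-- Lemma 2.4: bounds on the three vertical-derivative trilinear terms. -/
theorem stmt_9 :
    ∃ C : ℝ, 0 < C ∧ ∀ T : ℝ, 0 < T → ∀ (ψ : ℝ → Pt → ℝ) (v : Fin 3 → ℝ → Pt → ℝ),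
      SmoothOn2 (Icc 0 T) ψ → (∀ j, SmoothOn2 (Icc 0 T) (v j)) →
      (∀ t ∈ Icc (0:ℝ) T, IsSchwartz (ψ t) ∧ ∀ j, IsSchwartz (v j t)) →
      DivFree (Icc 0 T) v → FiniteClass T ψ v →
      (|∫ t in (0:ℝ)..T, ∫ x : Pt,
            pd 2 (ψ t) x * pd 2 (pd 2 (pd 2 (ψ t))) x * pd 2 (pd 2 (pd 2 (v 2 t))) x| ≤
          C * (supT T fun t => Real.sqrt (gradHSq 2 (ψ t)))
            * (l2T T fun t => Real.sqrt (gradHHSq 1 (ψ t)))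
            * (l2T T fun t => Real.sqrt (gradVecHSq 2 fun j => v j t))
            * (1 + supT T fun t => Real.sqrt (gradHSq 2 (ψ t)))) ∧
      (|∫ t in (0:ℝ)..T, ∫ x : Pt,
            pd 2 (pd 2 (ψ t)) x * pd 2 (pd 2 (pd 2 (ψ t))) x * pd 2 (pd 2 (v 2 t)) x| ≤
          C * (supT T fun t => Real.sqrt (gradHSq 2 (ψ t)))
            * (l2T T fun t => Real.sqrt (gradHHSq 1 (ψ t)))
            * (l2T T fun t => Real.sqrt (gradVecHSq 2 fun j => v j t))
            * (1 + supT T fun t => Real.sqrt (gradHSq 2 (ψ t)))) ∧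
      (|∫ t in (0:ℝ)..T, ∫ x : Pt,
            pd 2 (ψ t) x * pd 2 (pd 2 (pd 2 (ψ t))) x * pd 2 (pd 2 (v 2 t)) x
              * pd 2 (pd 2 (ψ t)) x| ≤
          C * (supT T fun t => Real.sqrt (gradHSq 2 (ψ t)))
            * (l2T T fun t => Real.sqrt (gradHHSq 1 (ψ t)))
            * (l2T T fun t => Real.sqrt (gradVecHSq 2 fun j => v j t))
            * (1 + supT T fun t => Real.sqrt (gradHSq 2 (ψ t)))) := by
  obtain ⟨C, hC, hb⟩ := exists_slice_bound_of_divFree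
  refine ⟨C, hC, fun T hT ψ v _ _ hS hdiv hfin => ?_⟩
  set S := supT T fun t => √(gradHSq 2 (ψ t))
  have hS0 : 0 ≤ S := Real.sSup_nonneg (by rintro _ ⟨t, _, rfl⟩; exact Real.sqrt_nonneg _)
  have hle : ∀ t ∈ Icc 0 T, √(gradHSq 2 (ψ t)) ≤ S := fun t ht =>
    le_csSup hfin.2.1 (mem_image_of_mem _ ht)
  have slice := fun t (ht : t ∈ Icc 0 T) =>
    hb (ψ t) (fun j => v j t) (hS t ht).1 (hS t ht).2 (hdiv t ht) S hS0 (hle t ht)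
  have hA : 0 ≤ C * S * (1 + S) := by positivity
  have main : ∀ u : ℝ → ℝ, (∀ t ∈ Icc 0 T, |u t| ≤ C * S * (1 + S) *
      (√(gradHHSq 1 (ψ t)) * √(gradVecHSq 2 fun j => v j t))) →
      |∫ t in (0 : ℝ)..T, u t| ≤ C * S * (l2T T fun t => √(gradHHSq 1 (ψ t)))
        * (l2T T fun t => √(gradVecHSq 2 fun j => v j t)) * (1 + S) := fun u hu =>
    (abs_integral_le_mul_l2T hT hA (fun t => gradHHSq_nonneg 1 _) (fun t => gradVecHSq_nonneg 2 _)
      hfin.2.2.2 hfin.2.2.1 hu).trans_eq (by ring)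
  exact ⟨main _ fun t ht => (slice t ht).1, main _ fun t ht => (slice t ht).2.1,
    main _ fun t ht => (slice t ht).2.2⟩

end
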